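/- arXiv:1611.09096 — 3 statements merged into one kernel-verified Lean document; each statement's English description precedes it below -/
import Mathlib

section
/- Let P be a set of n ≥ 3 points in convex position in the plane. Then any family of pairwise edge-disjoint 1-plane Hamiltonian cycles on P has cardinality at most ⌊n/3⌋. -/
open Finset

noncomputable section

/-- The Euclidean plane. -/
abbrev Pt : Type := EuclideanSpace ℝ (Fin 2)

/-- Strict counterclockwise orientation of an ordered triple of points. -/
def Ccw (p q r : Pt) : Prop :=
  0 < (q 0 - p 0) * (r 1 - p 1) - (q 1 - p 1) * (r 0 - p 0)

/-- `v` lists `n` points in convex position, labeled counterclockwise. -/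
def ConvexCcw {n : ℕ} (v : Fin n → Pt) : Prop :=
  ∀ i j k : Fin n, i < j → j < k → Ccw (v i) (v j) (v k)

/-- The open straight-line segment drawn for an unordered pair of indices. -/
def seg {n : ℕ} (v : Fin n → Pt) (e : Sym2 (Fin n)) : Set Pt :=
  Sym2.lift ⟨fun a b => openSegment ℝ (v a) (v b),
    fun a b => openSegment_symm ℝ (v a) (v b)⟩ e

/-- Two drawn edges cross: they share no endpoint and their open segments meet. -/
def EdgesCross {n : ℕ} (v : Fin n → Pt) (e f : Sym2 (Fin n)) : Prop :=
  (∀ a, a ∈ e → a ∉ f) ∧ (seg v e ∩ seg v f).Nonempty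

/-- A set of drawn edges is 1-plane: each edge is crossed by at most one other edge. -/
def OnePlane {n : ℕ} (v : Fin n → Pt) (E : Set (Sym2 (Fin n))) : Prop :=
  ∀ e ∈ E, {f | f ∈ E ∧ EdgesCross v e f}.Subsingleton

/-- `σ` is a Hamiltonian cycle on all `n` vertices. -/
def IsHamCycle {n : ℕ} (σ : Equiv.Perm (Fin n)) : Prop :=
  σ.IsCycle ∧ σ.support = Finset.univ

/-- The edge set of the Hamiltonian cycle `σ`. -/
def cycEdges {n : ℕ} (σ : Equiv.Perm (Fin n)) : Set (Sym2 (Fin n)) :=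
  {e | ∃ i : Fin n, e = s(i, σ i)}

/-- `σ` is a 1-plane Hamiltonian cycle for the point placement `v`. -/
def IsOnePlaneHC {n : ℕ} (v : Fin n → Pt) (σ : Equiv.Perm (Fin n)) : Prop :=
  IsHamCycle σ ∧ OnePlane v (cycEdges σ)

/-- `k` lies on the counterclockwise arc from `j` to `i` (inclusive), indices mod `n`. -/
def InArc {n : ℕ} (j i k : Fin n) : Prop := (k - j).val ≤ (i - j).val

/-- The residue class of an integer, as an index in `Fin n`. -/
def wrap (n : ℕ) [NeZero n] (x : ℤ) : Fin n :=
  ⟨(x % n).toNat, by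
    have hpos : (0 : ℤ) < n := by exact_mod_cast Nat.pos_of_ne_zero (NeZero.ne n)
    have h₁ := Int.emod_nonneg x hpos.ne'
    have h₂ := Int.emod_lt_of_pos x hpos
    omega⟩

section Wrap

variable {n : ℕ} [NeZero n]

lemma natCast_pos_of_neZero : (0 : ℤ) < n := by
  exact_mod_cast Nat.pos_of_ne_zero (NeZero.ne n)

lemma wrap_eq_wrap_iff {x y : ℤ} : wrap n x = wrap n y ↔ (n : ℤ) ∣ x - y := by
  have hpos : (0 : ℤ) < n := natCast_pos_of_neZero
  have h₁ := Int.emod_nonneg x hpos.ne'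
  have h₂ := Int.emod_nonneg y hpos.ne'
  rw [Int.dvd_iff_emod_eq_zero, ← Int.emod_eq_emod_iff_emod_sub_eq_zero]
  simp only [wrap, Fin.mk.injEq]
  omega

lemma wrap_add_mul (x k : ℤ) : wrap n (x + n * k) = wrap n x :=
  wrap_eq_wrap_iff.2 ⟨k, by ring⟩

lemma wrap_add_self (x : ℤ) : wrap n (x + n) = wrap n x :=
  wrap_eq_wrap_iff.2 ⟨1, by ring⟩

lemma eq_of_wrap_eq {x y : ℤ} (h : wrap n x = wrap n y) (hxy : x < y + n) (hyx : y < x + n) :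
    x = y := by
  have := Int.eq_zero_of_abs_lt_dvd (wrap_eq_wrap_iff.1 h) (abs_lt.2 ⟨by omega, by omega⟩)
  omega

lemma wrap_val {x : ℤ} (h₀ : 0 ≤ x) (h₁ : x < n) : ((wrap n x : ℕ) : ℤ) = x := by
  simp only [wrap]
  rw [Int.emod_eq_of_lt h₀ h₁]
  omega

lemma exists_wrap_eq (i : Fin n) (c : ℤ) : ∃ u, c ≤ u ∧ u < c + n ∧ wrap n u = i := by
  have hpos : (0 : ℤ) < n := natCast_pos_of_neZero
  refine ⟨c + (i - c) % n, ?_, ?_, ?_⟩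
  · have := Int.emod_nonneg (i - c : ℤ) hpos.ne'
    omega
  · have := Int.emod_lt_of_pos (i - c : ℤ) hpos
    omega
  · have h : wrap n (i : ℤ) = i := by
      apply Fin.ext
      have := wrap_val (n := n) (x := (i : ℤ)) (by omega) (by omega)
      exact_mod_cast this
    rw [← h, wrap_eq_wrap_iff, h]
    refine ⟨-((i - c) / n), ?_⟩
    have := Int.emod_add_mul_ediv (i - c : ℤ) n
    linarith

end Wrap

section Geometry

lemma openSegments_meet {n : ℕ} {v : Fin n → Pt} (hv : ConvexCcw v) {i j k l : Fin n}
    (hij : i < j) (hjk : j < k) (hkl : k < l) :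
    (openSegment ℝ (v i) (v k) ∩ openSegment ℝ (v j) (v l)).Nonempty := by
  have hα := hv j k l hjk hkl
  have hβ := hv i k l (hij.trans hjk) hkl
  have hγ := hv i j l hij (hjk.trans hkl)
  have hδ := hv i j k hij hjk
  unfold Ccw at hα hβ hγ hδ
  set α := (v k 0 - v j 0) * (v l 1 - v j 1) - (v k 1 - v j 1) * (v l 0 - v j 0) with hα'
  set β := (v k 0 - v i 0) * (v l 1 - v i 1) - (v k 1 - v i 1) * (v l 0 - v i 0) with hβ'
  set γ := (v j 0 - v i 0) * (v l 1 - v i 1) - (v j 1 - v i 1) * (v l 0 - v i 0) with hγ'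
  set δ := (v j 0 - v i 0) * (v k 1 - v i 1) - (v j 1 - v i 1) * (v k 0 - v i 0) with hδ'
  have hsum : α + γ = β + δ := by rw [hα', hβ', hγ', hδ']; ring
  have hs : 0 < α + γ := by linarith
  refine ⟨(α / (α + γ)) • v i + (γ / (α + γ)) • v k,
    ⟨_, _, div_pos hα hs, div_pos hγ hs, by field_simp, rfl⟩,
    ⟨β / (α + γ), δ / (α + γ), div_pos hβ hs, div_pos hδ hs, ?_, ?_⟩⟩
  · rw [← add_div, ← hsum, div_self hs.ne']
  · ext m
    simp only [PiLp.add_apply, PiLp.smul_apply, smul_eq_mul]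
    have key : β * v j m + δ * v l m = α * v i m + γ * v k m := by
      rw [hα', hβ', hγ', hδ']
      fin_cases m <;> simp <;> ring
    field_simp
    linarith

lemma edgesCross_wrap {n : ℕ} [NeZero n] {v : Fin n → Pt} (hv : ConvexCcw v) {x p y q : ℤ}
    (hxp : x < p) (hpy : p < y) (hyq : y < q) (hqx : q < x + n) :
    EdgesCross v s(wrap n x, wrap n y) s(wrap n p, wrap n q) := by
  constructor
  · have hne : ∀ {z w : ℤ}, z < w → w < z + n → wrap n z ≠ wrap n w := fun h₁ h₂ h => by
      have := eq_of_wrap_eq h (by omega) h₂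
      omega
    have h₁ := hne hxp (by omega)
    have h₂ := hne (hxp.trans (hpy.trans hyq)) hqx
    have h₃ := hne hpy (by omega)
    have h₄ := hne hyq (by omega)
    intro a ha hb
    rw [Sym2.mem_iff] at ha hb
    grind
  · obtain ⟨u, hu₀, hun, hu⟩ := exists_wrap_eq (wrap n x) 0
    obtain ⟨k, hk⟩ := wrap_eq_wrap_iff.1 hu
    have hshift : ∀ z, wrap n z = wrap n (z + n * k) := fun z => (wrap_add_mul z k).symm
    rw [hshift x, hshift p, hshift y, hshift q]
    set c : ℤ := n * k
    change (openSegment ℝ (v (wrap n (x + c))) (v (wrap n (y + c))) ∩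
      openSegment ℝ (v (wrap n (p + c))) (v (wrap n (q + c)))).Nonempty
    have val : ∀ z : ℤ, 0 ≤ z → z < 2 * n →
        ((wrap n z : ℕ) : ℤ) = if z < n then z else z - n := by
      intro z h₀ h₁
      split_ifs with h
      · exact wrap_val h₀ h
      · rw [← wrap_val (n := n) (x := z - n) (by omega) (by omega), ← wrap_add_self (z - n)]
        simp
    have hx := val (x + c) (by omega) (by omega)
    have hp := val (p + c) (by omega) (by omega)
    have hy := val (y + c) (by omega) (by omega)
    have hq := val (q + c) (by omega) (by omega)
    rw [if_pos (by omega)] at hx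
    by_cases h₁ : q + c < n
    · rw [if_pos (by omega)] at hp hy hq
      exact openSegments_meet hv (Fin.lt_def.2 (by omega)) (Fin.lt_def.2 (by omega))
        (Fin.lt_def.2 (by omega))
    rw [if_neg h₁] at hq
    by_cases h₂ : y + c < n
    · rw [if_pos (by omega)] at hp hy
      rw [Set.inter_comm, openSegment_symm ℝ (v (wrap n (p + c)))]
      exact openSegments_meet hv (Fin.lt_def.2 (by omega)) (Fin.lt_def.2 (by omega))
        (Fin.lt_def.2 (by omega))
    rw [if_neg h₂] at hy
    by_cases h₃ : p + c < n
    · rw [if_pos (by omega)] at hp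
      rw [openSegment_symm ℝ (v (wrap n (p + c))), openSegment_symm ℝ (v (wrap n (x + c)))]
      exact openSegments_meet hv (Fin.lt_def.2 (by omega)) (Fin.lt_def.2 (by omega))
        (Fin.lt_def.2 (by omega))
    · rw [if_neg h₃] at hp
      rw [Set.inter_comm, openSegment_symm ℝ (v (wrap n (x + c)))]
      exact openSegments_meet hv (Fin.lt_def.2 (by omega)) (Fin.lt_def.2 (by omega))
        (Fin.lt_def.2 (by omega))

end Geometry

/-- The undirected edges of a relation. -/
def Linked (S : ℤ → ℤ → Prop) (x y : ℤ) : Prop := S x y ∨ S y x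

/-- `S x y` says that a directed Hamiltonian cycle on `ℤ / n`, drawn on points in convex position
with every edge crossed at most once, goes from the class of `x` to the class of `y`. -/
structure IsOnePlaneCycle (n : ℤ) (S : ℤ → ℤ → Prop) : Prop where
  three_le : 3 ≤ n
  shift_left : ∀ x y, S (x + n) y ↔ S x y
  shift_right : ∀ x y, S x (y + n) ↔ S x y
  left_unique : ∀ {x y z}, S x y → S x z → y < z + n → z < y + n → y = z
  right_unique : ∀ {x y z}, S x z → S y z → x < y + n → y < x + n → x = y
  asymm : ∀ {x y}, S x y → ¬ S y x
  leave : ∀ {x y}, x + 2 ≤ y → y ≤ x + n → ∃ t u, x < t ∧ t < y ∧ y ≤ u ∧ u ≤ x + n ∧ S t u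
  cross_unique : ∀ {x y p q p' q'}, x < p → p < y → y < q → q < x + n →
    x < p' → p' < y → y < q' → q' < x + n →
    Linked S x y → Linked S p q → Linked S p' q' → p = p' ∧ q = q'

/-- The edges `{a - 1, b}` and `{a, b + 1}` are both traversed, in parallel directions. -/
def Parallel (S : ℤ → ℤ → Prop) (a b : ℤ) : Prop :=
  (S (a - 1) b ∧ S a (b + 1)) ∨ (S b (a - 1) ∧ S (b + 1) a)

/-- Positions `2 * h + 1` stand for the hull edges `{h, h + 1}` and positions `2 * h` for the
vertices `h`. A position is occupied if it is a hull edge of the cycle, or a vertex such that two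
sides of the triangle `h - 1, h, h + 1` are edges of the cycle. -/
def Occupied (E : ℤ → ℤ → Prop) (m : ℤ) : Prop :=
  ∃ h, (m = 2 * h + 1 ∧ E h (h + 1)) ∨
    (m = 2 * h ∧ ((E (h - 1) h ∧ E h (h + 1)) ∨
      (E (h - 1) (h + 1) ∧ (E (h - 1) h ∨ E h (h + 1)))))

namespace IsOnePlaneCycle

variable {n : ℤ} {S : ℤ → ℤ → Prop}

lemma enter (hS : IsOnePlaneCycle n S) {x y : ℤ} (hxy : x + 2 ≤ y) (hyx : y ≤ x + n) :
    ∃ t u, x < t ∧ t < y ∧ y ≤ u ∧ u ≤ x + n ∧ S u t := by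
  obtain ⟨t, u, h₁, h₂, h₃, h₄, h⟩ := hS.leave (x := y - 1) (y := x + n + 1) (by omega) (by omega)
  refine ⟨u - n, t, by omega, by omega, by omega, by omega, ?_⟩
  rw [← hS.shift_right]
  simpa using h

lemma linked_flip {x y : ℤ} : Linked (flip S) x y ↔ Linked S x y := or_comm

protected lemma flip (hS : IsOnePlaneCycle n S) : IsOnePlaneCycle n (flip S) where
  three_le := hS.three_le
  shift_left x y := hS.shift_right y x
  shift_right x y := hS.shift_left y x
  left_unique h₁ h₂ := hS.right_unique h₁ h₂
  right_unique h₁ h₂ := hS.left_unique h₁ h₂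
  asymm h := hS.asymm h
  leave := hS.enter
  cross_unique h₁ h₂ h₃ h₄ h₅ h₆ h₇ h₈ e₁ e₂ e₃ :=
    hS.cross_unique h₁ h₂ h₃ h₄ h₅ h₆ h₇ h₈ (linked_flip.1 e₁) (linked_flip.1 e₂)
      (linked_flip.1 e₃)

lemma linked_shift_right (hS : IsOnePlaneCycle n S) (x y : ℤ) :
    Linked S x (y + n) ↔ Linked S x y := by
  simp only [Linked, hS.shift_left, hS.shift_right]

lemma exists_next (hS : IsOnePlaneCycle n S) (t : ℤ) : ∃ u, t < u ∧ u < t + n ∧ S t u := by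
  have := hS.three_le
  obtain ⟨t', u, h₁, h₂, h₃, h₄, h⟩ := hS.leave (x := t - 1) (y := t + 1) (by omega) (by omega)
  obtain rfl : t' = t := by omega
  exact ⟨u, by omega, by omega, h⟩

lemma exists_crossing_of_dir (hS : IsOnePlaneCycle n S) {x y : ℤ} (h : S x y) (hxy : x + 2 ≤ y)
    (hyx : y + 2 ≤ x + n) : ∃ p q, x < p ∧ p < y ∧ y < q ∧ q < x + n ∧ Linked S p q := by
  by_contra! hno
  obtain ⟨t, u, h₁, h₂, h₃, h₄, htu⟩ := hS.leave hxy (by omega)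
  obtain ⟨t', u', h₁', h₂', h₃', h₄', htu'⟩ := hS.leave (x := y) (y := x + n) (by omega) (by omega)
  have hu : u = x + n := by
    by_contra hne
    rcases h₃.eq_or_lt with rfl | hlt
    · have := hS.right_unique h htu (by omega) (by omega)
      omega
    · exact hno t u h₁ h₂ hlt (by omega) (Or.inl htu)
  have hu' : u' = x + n := by
    by_contra hne
    rcases h₄'.eq_or_lt with rfl | hlt
    · have := hS.right_unique h ((hS.shift_right _ _).1 htu') (by omega) (by omega)
      omega
    · refine hno (u' - n) t' (by omega) (by omega) h₁' h₂' (Or.inr ?_)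
      rw [← hS.shift_right]
      simpa using htu'
  rw [hu] at htu
  rw [hu'] at htu'
  have := hS.right_unique htu htu' (by omega) (by omega)
  omega

lemma exists_crossing (hS : IsOnePlaneCycle n S) {x y : ℤ} (h : Linked S x y) (hxy : x + 2 ≤ y)
    (hyx : y + 2 ≤ x + n) : ∃ p q, x < p ∧ p < y ∧ y < q ∧ q < x + n ∧ Linked S p q := by
  rcases h with h | h
  · exact hS.exists_crossing_of_dir h hxy hyx
  · simpa only [linked_flip] using hS.flip.exists_crossing_of_dir h hxy hyx

lemma eq_add_one_of_cross (hS : IsOnePlaneCycle n S) {x p y q : ℤ} (hxp : x < p) (hpy : p < y)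
    (hyq : y < q) (hqx : q < x + n) (hxy : S x y) (hpq : S p q) : p = x + 1 := by
  by_contra hne
  obtain ⟨t, u, h₁, h₂, h₃, h₄, h⟩ := hS.enter (x := x) (y := p) (by omega) (by omega)
  rcases h₃.eq_or_lt with rfl | h₃
  · have := hS.left_unique hpq h (by omega) (by omega)
    omega
  rcases h₄.eq_or_lt with rfl | h₄
  · have := hS.left_unique hxy ((hS.shift_left _ _).1 h) (by omega) (by omega)
    omega
  rcases le_or_gt u y with huy | huy
  · have := hS.cross_unique (x := p) (y := q) (p := u) (q := t + n) (p' := y) (q' := x + n)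
      (by omega) (by omega) (by omega) (by omega) (by omega) (by omega) (by omega) (by omega)
      (Or.inl hpq) ((hS.linked_shift_right _ _).2 (Or.inl h))
      ((hS.linked_shift_right _ _).2 (Or.inr hxy))
    omega
  · have := hS.cross_unique (x := x) (y := y) (p := t) (q := u) (p' := p) (q' := q)
      (by omega) (by omega) (by omega) (by omega) (by omega) (by omega) (by omega) (by omega)
      (Or.inl hxy) (Or.inr h) (Or.inl hpq)
    omega

lemma parallel_of_dir (hS : IsOnePlaneCycle n S) {x y p q : ℤ} (h : S x y)
    (hxp : x < p) (hpy : p < y) (hyq : y < q) (hqx : q < x + n) (hpq : Linked S p q) :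
    Parallel S x (y - 1) ∨ Parallel S (x + 1) y := by
  have hsl := hS.shift_left
  have hsr := hS.shift_right
  rcases hpq with hpq | hqp
  · right; left
    have e₁ := hS.eq_add_one_of_cross hxp hpy hyq hqx h hpq
    have e₂ := hS.flip.eq_add_one_of_cross (x := y) (p := q) (y := x + n) (q := p + n)
      hyq hqx (by omega) (by omega) ((hsl _ _).2 h) ((hsl _ _).2 hpq)
    subst e₁ e₂
    simpa using ⟨h, hpq⟩
  · left; left
    have e₁ := hS.flip.eq_add_one_of_cross (x := p) (p := y) (y := q) (q := x + n)
      hpy hyq hqx (by omega) hqp ((hsl _ _).2 h)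
    have e₂ := hS.eq_add_one_of_cross (x := q) (p := x + n) (y := p + n) (q := y + n)
      hqx (by omega) (by omega) (by omega) ((hsr _ _).2 hqp) ((hsl _ _).2 ((hsr _ _).2 h))
    obtain rfl : q = x - 1 + n := by omega
    subst e₁
    rw [hsl] at hqp
    simpa using ⟨hqp, h⟩

lemma parallel_of_linked (hS : IsOnePlaneCycle n S) {x y : ℤ} (h : Linked S x y)
    (hxy : x + 2 ≤ y) (hyx : y + 2 ≤ x + n) : Parallel S x (y - 1) ∨ Parallel S (x + 1) y := by
  obtain ⟨p, q, h₁, h₂, h₃, h₄, hpq⟩ := hS.exists_crossing h hxy hyx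
  rcases h with h | h
  · exact hS.parallel_of_dir h h₁ h₂ h₃ h₄ hpq
  · have := hS.flip.parallel_of_dir h h₁ h₂ h₃ h₄ (linked_flip.2 hpq)
    exact this.imp Or.symm Or.symm

lemma occupied_of_sides {t : ℤ} (h₁ : Linked S (t - 1) t) (h₂ : Linked S t (t + 1)) :
    Occupied (Linked S) (2 * t) :=
  ⟨t, Or.inr ⟨rfl, Or.inl ⟨h₁, h₂⟩⟩⟩

lemma occupied_of_hull {t : ℤ} (h : Linked S t (t + 1)) : Occupied (Linked S) (2 * t + 1) :=
  ⟨t, Or.inl ⟨rfl, h⟩⟩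

/-- An arc cut off by two parallel crossing edges contains three consecutive occupied positions. -/
lemma exists_occupied_of_parallel (hS : IsOnePlaneCycle n S) {a b : ℤ} (hab : a < b)
    (hba : b + 2 < a + n) (h : Parallel S a b) :
    ∃ m, 2 * a ≤ m ∧ m + 2 ≤ 2 * b ∧ Occupied (Linked S) m ∧ Occupied (Linked S) (m + 1) ∧
      Occupied (Linked S) (m + 2) := by
  induction hk : (b - a).toNat using Nat.strong_induction_on generalizing a b with
  | _ k ih =>
  have e₁ : Linked S (a - 1) b := h.imp And.left And.left
  have e₂ : Linked S a (b + 1) := h.imp And.right And.right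
  rcases (show a + 1 ≤ b by omega).eq_or_lt with rfl | hlt
  · have key : ∀ {R : ℤ → ℤ → Prop}, IsOnePlaneCycle n R → R (a - 1) (a + 1) →
        R a (a + 2) → R (a + 1) a := by
      intro R hR f₁ f₂
      obtain ⟨u, hu₁, hu₂, hu⟩ := hR.exists_next (a + 1)
      have hu₃ : u ≠ a + 2 := by
        rintro rfl
        have := hR.right_unique f₂ hu (by omega) (by omega)
        omega
      have hu₄ : u ≠ a - 1 + n := by
        rintro rfl
        exact hR.asymm f₁ ((hR.shift_right _ _).1 hu)
      have hu₅ : ¬ (u < a + n) := by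
        intro hlt
        have := hR.cross_unique (x := a) (y := a + 2) (p := a + 1) (q := u) (p' := a + 1)
          (q' := a - 1 + n) (by omega) (by omega) (by omega) (by omega) (by omega) (by omega)
          (by omega) (by omega) (Or.inl f₂) (Or.inl hu)
          ((hR.linked_shift_right _ _).2 (Or.inr f₁))
        omega
      obtain rfl : u = a + n := by omega
      exact (hR.shift_right _ _).1 hu
    have hb : a + 1 + 1 = a + 2 := by ring
    rw [Parallel, hb] at h
    have e₃ : Linked S a (a + 1) := by
      rcases h with ⟨f₁, f₂⟩ | ⟨f₁, f₂⟩
      · exact Or.inr (key hS f₁ f₂)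
      · exact Or.inl (key hS.flip f₁ f₂)
    refine ⟨2 * a, le_rfl, by omega, ⟨a, Or.inr ⟨rfl, Or.inr ⟨e₁, Or.inr e₃⟩⟩⟩,
      occupied_of_hull e₃, a + 1, Or.inr ⟨by ring, Or.inr ⟨?_, Or.inl ?_⟩⟩⟩
    · simpa using e₂
    · simpa using e₃
  · have inside : ∀ u, a + 1 < u → u < a + 1 + n → Linked S (a + 1) u → u = a + n ∨ u ≤ b := by
      intro u hu₁ hu₂ hu
      by_contra! hcon
      rcases (show b + 1 ≤ u by omega).eq_or_lt with rfl | hu₃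
      · have := hS.cross_unique (x := a - 1) (y := b) (p := a + 1) (q := b + 1) (p' := a)
          (q' := b + 1) (by omega) (by omega) (by omega) (by omega) (by omega) (by omega)
          (by omega) (by omega) e₁ hu e₂
        omega
      · have := hS.cross_unique (x := a) (y := b + 1) (p := a + 1) (q := u) (p' := b)
          (q' := a - 1 + n) (by omega) (by omega) (by omega) (by omega) (by omega) (by omega)
          (by omega) (by omega) e₂ hu ((hS.linked_shift_right _ _).2 e₁.symm)
        omega
    obtain ⟨u, hu₁, hu₂, hu⟩ := hS.exists_next (a + 1)
    obtain ⟨w, hw₁, hw₂, hw⟩ := hS.flip.exists_next (a + 1)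
    have huw : u ≠ w := by
      rintro rfl
      exact hS.asymm hu hw
    have recurse : ∀ y, a + 3 ≤ y → y ≤ b → Linked S (a + 1) y →
        ∃ m, 2 * a ≤ m ∧ m + 2 ≤ 2 * b ∧ Occupied (Linked S) m ∧
          Occupied (Linked S) (m + 1) ∧ Occupied (Linked S) (m + 2) := by
      intro y hy₁ hy₂ hy
      rcases hS.parallel_of_linked hy (by omega) (by omega) with hp | hp
      · obtain ⟨m, h₁, h₂, h₃⟩ := ih _ (by omega) (by omega) (by omega) hp rfl
        exact ⟨m, by omega, by omega, h₃⟩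
      · obtain ⟨m, h₁, h₂, h₃⟩ := ih _ (by omega) (by omega) (by omega) hp rfl
        exact ⟨m, by omega, by omega, h₃⟩
    have finish : Linked S a (a + 1) → Linked S (a + 1) (a + 2) →
        ∃ m, 2 * a ≤ m ∧ m + 2 ≤ 2 * b ∧ Occupied (Linked S) m ∧
          Occupied (Linked S) (m + 1) ∧ Occupied (Linked S) (m + 2) := by
      intro f₁ f₂
      have f₃ : Linked S (a + 1) (a + 1 + 1) := by rwa [add_assoc]
      refine ⟨2 * a + 1, by omega, by omega, occupied_of_hull f₁, ?_, ?_⟩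
      · have := occupied_of_sides (t := a + 1) (by simpa using f₁) f₃
        rwa [show 2 * (a + 1) = 2 * a + 1 + 1 by ring] at this
      · have := occupied_of_hull f₃
        rwa [show 2 * (a + 1) + 1 = 2 * a + 1 + 2 by ring] at this
    have ju : Linked S (a + 1) u := Or.inl hu
    have jw : Linked S (a + 1) w := Or.inr hw
    have back : ∀ {z}, z = a + n → Linked S (a + 1) z → Linked S a (a + 1) := by
      rintro _ rfl hz
      exact ((hS.linked_shift_right _ _).1 hz).symm
    by_cases hu₃ : a + 3 ≤ u ∧ u ≤ b
    · exact recurse u hu₃.1 hu₃.2 ju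
    by_cases hw₃ : a + 3 ≤ w ∧ w ≤ b
    · exact recurse w hw₃.1 hw₃.2 jw
    have hu₄ := inside u hu₁ hu₂ ju
    have hw₄ := inside w hw₁ hw₂ jw
    by_cases hu₅ : u = a + n
    · obtain rfl : w = a + 2 := by omega
      exact finish (back hu₅ ju) jw
    · obtain rfl : u = a + 2 := by omega
      exact finish (back (by omega) jw) ju

lemma linked_succ_of_no_chord (hS : IsOnePlaneCycle n S)
    (hno : ∀ x y, x + 2 ≤ y → y + 2 ≤ x + n → ¬ Linked S x y) (t : ℤ) :
    Linked S t (t + 1) := by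
  obtain ⟨u, hu₁, hu₂, hu⟩ := hS.exists_next t
  obtain ⟨w, hw₁, hw₂, hw⟩ := hS.flip.exists_next t
  have huw : u ≠ w := by
    rintro rfl
    exact hS.asymm hu hw
  have ju := hno t u
  have jw := hno t w
  have ju' : Linked S t u := Or.inl hu
  have jw' : Linked S t w := Or.inr hw
  by_cases hu₃ : u = t + 1
  · rwa [← hu₃]
  · obtain rfl : w = t + 1 := by
      by_contra hw₃
      have : u + 2 > t + n := by
        by_contra! hcon
        exact ju (by omega) hcon ju'
      have : w + 2 > t + n := by
        by_contra! hcon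
        exact jw (by omega) hcon jw'
      omega
    exact jw'

/-- Two disjoint triples of consecutive occupied positions fit in one period. -/
lemma exists_two_occupied (hS : IsOnePlaneCycle n S) :
    ∃ m₁ m₂, m₁ + 3 ≤ m₂ ∧ m₂ + 3 ≤ m₁ + 2 * n ∧
      ∀ i, 0 ≤ i → i < 3 → Occupied (Linked S) (m₁ + i) ∧ Occupied (Linked S) (m₂ + i) := by
  have h3 := hS.three_le
  by_cases hno : ∀ x y, x + 2 ≤ y → y + 2 ≤ x + n → ¬ Linked S x y
  · have hull := hS.linked_succ_of_no_chord hno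
    have all : ∀ m, Occupied (Linked S) m := by
      intro m
      rcases Int.even_or_odd' m with ⟨h, rfl | rfl⟩
      · exact occupied_of_sides (by simpa using hull (h - 1)) (hull h)
      · exact occupied_of_hull (hull h)
    exact ⟨0, 3, by omega, by omega, fun i _ _ => ⟨all _, all _⟩⟩
  · push Not at hno
    obtain ⟨x, y, hxy, hyx, hj⟩ := hno
    obtain ⟨a, b, hab, hba, hp⟩ : ∃ a b, a < b ∧ b + 2 < a + n ∧ Parallel S a b := by
      rcases hS.parallel_of_linked hj hxy hyx with hp | hp
      · exact ⟨_, _, by omega, by omega, hp⟩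
      · exact ⟨_, _, by omega, by omega, hp⟩
    have hp' : Parallel S (b + 1) (a - 1 + n) := by
      have e : a - 1 + n + 1 = a + n := by ring
      unfold Parallel at hp ⊢
      rw [e]
      simp only [hS.shift_left, hS.shift_right, add_sub_cancel_right]
      exact hp.symm
    obtain ⟨m₁, h₁, h₂, o₁⟩ := hS.exists_occupied_of_parallel hab hba hp
    obtain ⟨m₂, h₃, h₄, o₂⟩ := hS.exists_occupied_of_parallel (by omega) (by omega) hp'
    refine ⟨m₁, m₂, by omega, by omega, fun i hi₀ hi₃ => ?_⟩
    obtain rfl | rfl | rfl : i = 0 ∨ i = 1 ∨ i = 2 := by omega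
    · simpa using ⟨o₁.1, o₂.1⟩
    · exact ⟨o₁.2.1, o₂.2.1⟩
    · exact ⟨o₁.2.2, o₂.2.2⟩

end IsOnePlaneCycle

section Cycles

lemma IsHamCycle.mem_of_mapsTo {n : ℕ} {σ : Equiv.Perm (Fin n)} (hσ : IsHamCycle σ)
    {X : Set (Fin n)} (hX : X.Nonempty) (hmaps : Set.MapsTo σ X X) (j : Fin n) : j ∈ X := by
  obtain ⟨i, hi⟩ := hX
  have moved : ∀ k, σ k ≠ k := fun k => by
    rw [← Equiv.Perm.mem_support, hσ.2]
    exact Finset.mem_univ k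
  obtain ⟨k, rfl⟩ := hσ.1.exists_pow_eq (moved i) (moved j)
  rw [← Equiv.Perm.iterate_eq_pow]
  exact hmaps.iterate k hi

variable {n : ℕ} [NeZero n]

/-- The relation on integers induced by a permutation of the indices. -/
def stepRel (σ : Equiv.Perm (Fin n)) (x y : ℤ) : Prop := σ (wrap n x) = wrap n y

lemma linked_stepRel_iff {σ : Equiv.Perm (Fin n)} {x y : ℤ} :
    Linked (stepRel σ) x y ↔ s(wrap n x, wrap n y) ∈ cycEdges σ := by
  simp only [Linked, stepRel, cycEdges, Set.mem_ofPred_eq, Sym2.eq_iff]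
  constructor
  · rintro (h | h)
    · exact ⟨_, Or.inl ⟨rfl, h.symm⟩⟩
    · exact ⟨_, Or.inr ⟨h.symm, rfl⟩⟩
  · rintro ⟨i, ⟨rfl, h⟩ | ⟨h, rfl⟩⟩
    · exact Or.inl h.symm
    · exact Or.inr h.symm

lemma IsOnePlaneHC.isOnePlaneCycle (hn : 3 ≤ n) {v : Fin n → Pt} (hv : ConvexCcw v)
    {σ : Equiv.Perm (Fin n)} (hσ : IsOnePlaneHC v σ) : IsOnePlaneCycle n (stepRel σ) where
  three_le := by exact_mod_cast hn
  shift_left x y := by simp only [stepRel, wrap_add_self]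
  shift_right x y := by simp only [stepRel, wrap_add_self]
  left_unique h₁ h₂ := eq_of_wrap_eq (h₁.symm.trans h₂)
  right_unique h₁ h₂ := eq_of_wrap_eq (σ.injective (h₁.trans h₂.symm))
  asymm := by
    intro x y h₁ h₂
    unfold stepRel at h₁ h₂
    have hall := hσ.1.mem_of_mapsTo (X := {wrap n x, wrap n y}) ⟨_, Or.inl rfl⟩ (by
      rintro i (rfl | rfl)
      · exact Or.inr h₁
      · exact Or.inl h₂)
    have hcard : Fintype.card (Fin n) ≤ 2 := by
      rw [← Finset.card_univ]
      calc (Finset.univ : Finset (Fin n)).card ≤ ({wrap n x, wrap n y} : Finset (Fin n)).card :=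
            Finset.card_le_card fun i _ => by simpa using hall i
        _ ≤ 2 := Finset.card_le_two
    rw [Fintype.card_fin] at hcard
    omega
  leave := by
    intro x y hxy hyx
    by_contra! hno
    have hx := hσ.1.mem_of_mapsTo (X := {i | ∃ t, x < t ∧ t < y ∧ wrap n t = i})
      ⟨wrap n (x + 1), x + 1, by omega, by omega, rfl⟩ (by
        rintro _ ⟨t, ht₁, ht₂, rfl⟩
        obtain ⟨u, hu₁, hu₂, hu⟩ := exists_wrap_eq (σ (wrap n t)) (x + 1)
        refine ⟨u, by omega, ?_, hu⟩
        by_contra! hyu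
        exact hno t u ht₁ ht₂ hyu (by omega) hu.symm) (wrap n x)
    obtain ⟨t, ht₁, ht₂, ht⟩ := hx
    have := eq_of_wrap_eq ht (by omega) (by omega)
    omega
  cross_unique := by
    intro x y p q p' q' h₁ h₂ h₃ h₄ h₁' h₂' h₃' h₄' e e₁ e₂
    have heq := hσ.2 _ (linked_stepRel_iff.1 e)
      ⟨linked_stepRel_iff.1 e₁, edgesCross_wrap hv h₁ h₂ h₃ h₄⟩
      ⟨linked_stepRel_iff.1 e₂, edgesCross_wrap hv h₁' h₂' h₃' h₄'⟩
    rcases Sym2.eq_iff.1 heq with ⟨g₁, g₂⟩ | ⟨g₁, g₂⟩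
    · exact ⟨eq_of_wrap_eq g₁ (by omega) (by omega), eq_of_wrap_eq g₂ (by omega) (by omega)⟩
    · have := eq_of_wrap_eq g₁ (by omega) (by omega)
      omega

lemma Occupied.emod {σ : Equiv.Perm (Fin n)} {m : ℤ} (h : Occupied (Linked (stepRel σ)) m) :
    Occupied (Linked (stepRel σ)) (m % (2 * n)) := by
  obtain ⟨t, ht⟩ := h
  set k := -(m / (2 * n)) with hk
  have hm : m % (2 * n) = m + 2 * (n * k) := by
    have := Int.emod_add_mul_ediv m (2 * n)
    rw [hk]
    linarith
  have hj : ∀ x y : ℤ,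
      Linked (stepRel σ) (x + n * k) (y + n * k) ↔ Linked (stepRel σ) x y := fun x y => by
    simp only [Linked, stepRel, wrap_add_mul]
  have e₁ : t + n * k + 1 = t + 1 + n * k := by ring
  have e₂ : t + n * k - 1 = t - 1 + n * k := by ring
  refine ⟨t + n * k, ?_⟩
  rw [e₁, e₂]
  simp only [hj]
  refine ht.imp (And.imp_left fun h => ?_) (And.imp_left fun h => ?_) <;> rw [hm, h] <;> ring

open scoped Classical in
/-- The occupied positions of a cycle in the fundamental period. -/
def occupiedFinset (σ : Equiv.Perm (Fin n)) : Finset ℤ :=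
  {m ∈ Finset.Ico (0 : ℤ) (2 * n) | Occupied (Linked (stepRel σ)) m}

lemma occupiedFinset_subset (σ : Equiv.Perm (Fin n)) :
    occupiedFinset σ ⊆ Finset.Ico (0 : ℤ) (2 * n) := by
  classical exact Finset.filter_subset _ _

lemma IsOnePlaneHC.six_le_card_occupiedFinset (hn : 3 ≤ n) {v : Fin n → Pt} (hv : ConvexCcw v)
    {σ : Equiv.Perm (Fin n)} (hσ : IsOnePlaneHC v σ) : 6 ≤ (occupiedFinset σ).card := by
  obtain ⟨m₁, m₂, h₁, h₂, h⟩ := (hσ.isOnePlaneCycle hn hv).exists_two_occupied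
  have hdisj : Disjoint (Finset.Ico m₁ (m₁ + 3)) (Finset.Ico m₂ (m₂ + 3)) := by
    rw [Finset.disjoint_left]
    intro a ha hb
    rw [Finset.mem_Ico] at ha hb
    omega
  have hcard : (Finset.Ico m₁ (m₁ + 3) ∪ Finset.Ico m₂ (m₂ + 3)).card = 6 := by
    rw [Finset.card_union_of_disjoint hdisj]
    simp
  rw [← hcard]
  have hpos : (0 : ℤ) < 2 * n := by omega
  refine Finset.card_le_card_of_injOn (· % (2 * n : ℤ)) ?_ ?_
  · intro m hm
    rw [Finset.mem_coe, Finset.mem_union, Finset.mem_Ico, Finset.mem_Ico] at hm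
    simp only [occupiedFinset, Finset.coe_filter, Finset.mem_Ico, Set.mem_ofPred_eq]
    refine ⟨⟨Int.emod_nonneg _ hpos.ne', Int.emod_lt_of_pos _ hpos⟩, Occupied.emod ?_⟩
    rcases hm with hm | hm
    · simpa using (h (m - m₁) (by omega) (by omega)).1
    · simpa using (h (m - m₂) (by omega) (by omega)).2
  · intro a ha b hb hab
    rw [Finset.mem_coe, Finset.mem_union, Finset.mem_Ico, Finset.mem_Ico] at ha hb
    have := Int.eq_zero_of_abs_lt_dvd
      (Int.dvd_of_emod_eq_zero (Int.emod_eq_emod_iff_emod_sub_eq_zero.1 hab))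
      (abs_lt.2 ⟨by omega, by omega⟩)
    omega

lemma disjoint_occupiedFinset {σ τ : Equiv.Perm (Fin n)}
    (h : Disjoint (cycEdges σ) (cycEdges τ)) :
    Disjoint (occupiedFinset σ) (occupiedFinset τ) := by
  have hE : ∀ x y, Linked (stepRel σ) x y → ¬ Linked (stepRel τ) x y := fun x y h₁ h₂ =>
    Set.disjoint_left.1 h (linked_stepRel_iff.1 h₁) (linked_stepRel_iff.1 h₂)
  rw [Finset.disjoint_left]
  intro m h₁ h₂
  simp only [occupiedFinset, Finset.mem_filter] at h₁ h₂
  obtain ⟨a, ha⟩ := h₁.2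
  obtain ⟨b, hb⟩ := h₂.2
  obtain rfl : a = b := by omega
  have e₁ := hE a (a + 1)
  have e₂ := hE (a - 1) a
  have e₃ := hE (a - 1) (a + 1)
  rcases ha with ⟨rfl, ha⟩ | ⟨rfl, ha⟩ <;> rcases hb with ⟨hm, hb⟩ | ⟨hm, hb⟩
  · exact e₁ ha hb
  · omega
  · omega
  · tauto

end Cycles

/-- any family of pairwise edge-disjoint 1-plane Hamiltonian cycles
on `n ≥ 3` points in convex position has cardinality at most `⌊n / 3⌋`. -/
theorem stmt7 {n : ℕ} (hn : 3 ≤ n) (v : Fin n → Pt) (hconv : ConvexCcw v)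
    (S : Finset (Equiv.Perm (Fin n)))
    (hS : ∀ σ ∈ S, IsOnePlaneHC v σ)
    (hdisj : ∀ σ ∈ S, ∀ τ ∈ S, σ ≠ τ → Disjoint (cycEdges σ) (cycEdges τ)) :
    S.card ≤ n / 3 := by
  have : NeZero n := ⟨by omega⟩
  have hunion : (S.biUnion occupiedFinset).card = ∑ σ ∈ S, (occupiedFinset σ).card :=
    Finset.card_biUnion fun σ hσ τ hτ hne => disjoint_occupiedFinset (hdisj σ hσ τ hτ hne)
  have hupper : (S.biUnion occupiedFinset).card ≤ 2 * n := by
    calc (S.biUnion occupiedFinset).card ≤ (Finset.Ico (0 : ℤ) (2 * n)).card :=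
          Finset.card_le_card (Finset.biUnion_subset.2 fun σ _ => occupiedFinset_subset σ)
      _ = 2 * n := by simp; omega
  have hlower : S.card * 6 ≤ ∑ σ ∈ S, (occupiedFinset σ).card := by
    rw [← smul_eq_mul]
    exact Finset.card_nsmul_le_sum _ _ _ fun σ hσ =>
      (hS σ hσ).six_le_card_occupiedFinset hn hconv
  omega

end
end

section
/- Let P be a set of n ≥ 3 points in convex position in the plane. Then there exists a family of ⌊n/3⌋ pairwise edge-disjoint 1-plane Hamiltonian cycles on P. -/
open Finset

noncomputable section

/-- The signed area form of an ordered triple of points. -/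
def orient (p q r : Pt) : ℝ :=
  (q 0 - p 0) * (r 1 - p 1) - (q 1 - p 1) * (r 0 - p 0)

lemma orient_swap (p q r : Pt) : orient p r q = -orient p q r := by
  unfold orient; ring

lemma orient_rotate (p q r : Pt) : orient q r p = orient p q r := by
  unfold orient; ring

/-- Segments do not meet when both endpoints of one lie strictly on the same side of the other. -/
lemma openSegment_inter_eq_empty {p q r s : Pt} (h : 0 < orient p q r * orient p q s) :
    ¬ (openSegment ℝ p q ∩ openSegment ℝ r s).Nonempty := by
  rintro ⟨z, ⟨a, b, -, -, hab, rfl⟩, c, d, hc, hd, hcd, hz⟩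
  have h0 := congrArg (fun w : Pt => w 0) hz
  have h1 := congrArg (fun w : Pt => w 1) hz
  simp only [PiLp.add_apply, PiLp.smul_apply, smul_eq_mul] at h0 h1
  have key : c * orient p q r + d * orient p q s = 0 := by
    have ha : a = 1 - b := by linarith
    have hc' : c = 1 - d := by linarith
    subst ha hc'
    unfold orient
    linear_combination (q 0 - p 0) * h1 - (q 1 - p 1) * h0
  rcases pos_and_pos_or_neg_and_neg_of_mul_pos h with ⟨h2, h3⟩ | ⟨h2, h3⟩
  · nlinarith [mul_pos hc h2, mul_pos hd h3]
  · nlinarith [mul_neg_of_pos_of_neg hc h2, mul_neg_of_pos_of_neg hd h3]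

section Crossing

variable {n : ℕ} {v : Fin n → Pt}

lemma ConvexCcw.orient_pos (hv : ConvexCcw v) {i j k : Fin n} (hij : i < j) (hjk : j < k) :
    0 < orient (v i) (v j) (v k) := hv i j k hij hjk

/-- Two chords whose second has both endpoints outside or both inside the first are disjoint. -/
lemma ConvexCcw.not_meet (hv : ConvexCcw v) {a b x y : Fin n} (hab : a < b) (hxy : x < y)
    (h : b < x ∨ y < a ∨ (a < x ∧ y < b) ∨ (x < a ∧ b < y)) :
    ¬ (openSegment ℝ (v a) (v b) ∩ openSegment ℝ (v x) (v y)).Nonempty := by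
  apply openSegment_inter_eq_empty
  rcases h with h | h | ⟨h, h'⟩ | ⟨h, h'⟩
  · exact mul_pos (hv.orient_pos hab h) (hv.orient_pos hab (h.trans hxy))
  · have h1 := hv.orient_pos (hxy.trans h) hab
    have h2 := hv.orient_pos h hab
    rw [← orient_rotate] at h1 h2
    exact mul_pos h1 h2
  · have h1 := hv.orient_pos h (hxy.trans h')
    have h2 := hv.orient_pos (h.trans hxy) h'
    rw [orient_swap, orient_swap _ (v y), neg_mul_neg]
    exact mul_pos h1 h2
  · have h1 := hv.orient_pos h hab
    rw [← orient_rotate] at h1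
    exact mul_pos h1 (hv.orient_pos hab h')

/-- Crossing edges have interleaving endpoints. -/
lemma ConvexCcw.interleave (hv : ConvexCcw v) {a b x y : Fin n} (hab : a < b) (hxy : x < y)
    (h : EdgesCross v s(a, b) s(x, y)) :
    (a < x ∧ x < b ∧ b < y) ∨ (x < a ∧ a < y ∧ y < b) := by
  obtain ⟨hne, hmeet⟩ := h
  have hmeet' : (openSegment ℝ (v a) (v b) ∩ openSegment ℝ (v x) (v y)).Nonempty := hmeet
  have hnot := fun h => hv.not_meet hab hxy h hmeet'
  have ha := hne a (by simp)
  have hb := hne b (by simp)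
  simp only [Sym2.mem_iff, not_or] at ha hb
  grind

end Crossing

/-- The sum `a + b` is congruent to `c - 1`, `c` or `c + 1` modulo `n`. -/
def NearSum (n : ℕ) (c a b : ℤ) : Prop :=
  ∃ d k : ℤ, -1 ≤ d ∧ d ≤ 1 ∧ a + b = c + d + n * k

lemma NearSum.symm {n : ℕ} {c a b : ℤ} (h : NearSum n c a b) : NearSum n c b a := by
  obtain ⟨d, k, h1, h2, h⟩ := h
  exact ⟨d, k, h1, h2, by linarith⟩

/-- Two interleaving chords with sums near `c` are mirror images of each other. -/
lemma NearSum.interleave_eq {n : ℕ} (hn : 3 ≤ n) {c a b x y : ℤ}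
    (hab : NearSum n c a b) (hxy : NearSum n c x y)
    (ha : 0 ≤ a) (hax : a < x) (hxb : x < b) (hby : b < y) (hy : y < n) :
    (x = a + 1 ∧ y = b + 1 ∧ ∃ k : ℤ, a + b = c - 1 + n * k) ∨
      (a = 0 ∧ y = n - 1 ∧ b = x + 1 ∧ ∃ k : ℤ, a + b = c + 1 + n * k) := by
  obtain ⟨d, k, hd, hd', h⟩ := hab
  obtain ⟨e, l, he, he', h'⟩ := hxy
  have hn' : (3 : ℤ) ≤ n := by exact_mod_cast hn
  have hlk : (n : ℤ) * (l - k) = x + y - a - b - e + d := by linarith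
  have h1 : l - k < 2 := by by_contra! hcon; nlinarith
  have h2 : -1 < l - k := by by_contra! hcon; nlinarith
  obtain hl | hl : l - k = 0 ∨ l - k = 1 := by omega
  · rw [hl] at hlk
    exact .inl ⟨by linarith, by linarith, k, by linarith⟩
  · rw [hl] at hlk
    exact .inr ⟨by linarith, by linarith, by linarith, k, by linarith⟩

lemma not_both_signs {n : ℕ} (hn : 3 ≤ n) {c s : ℤ} (h : ∃ k : ℤ, s = c - 1 + n * k)
    (h' : ∃ k : ℤ, s = c + 1 + n * k) : False := by
  obtain ⟨k, hk⟩ := h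
  obtain ⟨l, hl⟩ := h'
  have h2 : (n : ℤ) ∣ 2 := ⟨k - l, by linarith⟩
  have := Int.le_of_dvd (by norm_num) h2
  omega

/-- A set of edges whose endpoint sums are all near `c` is 1-plane. -/
lemma onePlane_of_nearSum {n : ℕ} (hn : 3 ≤ n) {v : Fin n → Pt} (hv : ConvexCcw v) {c : ℤ}
    {E : Set (Sym2 (Fin n))}
    (hE : ∀ e ∈ E, ∃ a b : Fin n, a < b ∧ e = s(a, b) ∧ NearSum n c a b) : OnePlane v E := by
  have key : ∀ {a b x y : Fin n}, a < b → x < y → NearSum n c a b → NearSum n c x y →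
      EdgesCross v s(a, b) s(x, y) →
      ((x : ℤ) = a + 1 ∧ (y : ℤ) = b + 1 ∧ ∃ k : ℤ, (a + b : ℤ) = c - 1 + n * k) ∨
      ((a : ℤ) = 0 ∧ (y : ℤ) = n - 1 ∧ (b : ℤ) = x + 1 ∧ ∃ k : ℤ, (a + b : ℤ) = c + 1 + n * k) ∨
      ((a : ℤ) = x + 1 ∧ (b : ℤ) = y + 1 ∧ ∃ k : ℤ, (a + b : ℤ) = c + 1 + n * k) ∨
      ((x : ℤ) = 0 ∧ (b : ℤ) = n - 1 ∧ (y : ℤ) = a + 1 ∧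
        ∃ k : ℤ, (a + b : ℤ) = c - 1 + n * k) := by
    intro a b x y hab hxy h h' hc
    rcases hv.interleave hab hxy hc with ⟨h1, h2, h3⟩ | ⟨h1, h2, h3⟩
    · rcases h.interleave_eq hn h' (by omega) (by omega) (by omega) (by omega) (by omega)
        with h4 | h4
      · exact .inl h4
      · exact .inr (.inl h4)
    · rcases h'.interleave_eq hn h (by omega) (by omega) (by omega) (by omega) (by omega)
        with ⟨h4, h5, k, h6⟩ | ⟨h4, h5, h6, k, h7⟩
      · exact .inr (.inr (.inl ⟨h4, h5, k, by linarith⟩))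
      · exact .inr (.inr (.inr ⟨h4, h5, h6, k + 1, by linarith⟩))
  intro e he f hf g hg
  obtain ⟨a, b, hab, rfl, hs⟩ := hE e he
  obtain ⟨x, y, hxy, rfl, hs1⟩ := hE f hf.1
  obtain ⟨z, w, hzw, rfl, hs2⟩ := hE g hg.1
  suffices x = z ∧ y = w by rw [this.1, this.2]
  have contra := fun h h' => not_both_signs (c := c) (s := (a + b : ℤ)) hn h h'
  rcases key hab hxy hs hs1 hf.2 with h | h | h | h <;>
    rcases key hab hzw hs hs2 hg.2 with h' | h' | h' | h' <;>
    first
    | exact (contra (by tauto) (by tauto)).elim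
    | omega

/-- A sequence of integers, injective modulo `n` and with cyclically consecutive sums near `c`,
yields a Hamiltonian cycle. -/
lemma exists_hamCycle_of_seq {n : ℕ} (hn : 3 ≤ n) {c : ℤ} (g : ℕ → ℤ)
    (hinj : ∀ s t, s < t → t < n → ¬ (n : ℤ) ∣ g t - g s)
    (hnear : ∀ t, t + 1 < n → NearSum n c (g t) (g (t + 1)))
    (hlast : NearSum n c (g (n - 1)) (g 0)) :
    ∃ σ : Equiv.Perm (Fin n), IsHamCycle σ ∧ ∀ i : Fin n, NearSum n c i (σ i) := by
  have hn0 : (0 : ℤ) < n := by omega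
  have hlt : ∀ z : ℤ, (z % n).toNat < n := fun z => by
    have := Int.emod_lt_of_pos z hn0
    omega
  let e : Fin n → Fin n := fun t => ⟨(g t % n).toNat, hlt _⟩
  have he : ∀ t : Fin n, ((e t : ℕ) : ℤ) = g t % n := fun t =>
    Int.toNat_of_nonneg (Int.emod_nonneg _ hn0.ne')
  have heinj : Function.Injective e := by
    intro s t hst
    have hmod : g s % n = g t % n := by rw [← he, ← he, hst]
    rcases lt_trichotomy s t with h | h | h
    · exact (hinj s t h t.2 (Int.ModEq.dvd hmod)).elim
    · exact h
    · exact (hinj t s h s.2 (Int.ModEq.dvd hmod.symm)).elim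
  have hred : ∀ s t : Fin n, NearSum n c (g s) (g t) → NearSum n c (e s) (e t) := by
    rintro s t ⟨d, k, hd, hd', h⟩
    refine ⟨d, k - g s / n - g t / n, hd, hd', ?_⟩
    have h1 := Int.emod_add_mul_ediv (g s) n
    have h2 := Int.emod_add_mul_ediv (g t) n
    rw [he, he]
    linear_combination h + h1 + h2
  let q : Equiv.Perm (Fin n) := Equiv.ofBijective e (Finite.injective_iff_bijective.mp heinj)
  obtain ⟨m, rfl⟩ : ∃ m, n = m + 2 := ⟨n - 2, by omega⟩
  refine ⟨q * finRotate (m + 2) * q⁻¹, ⟨isCycle_finRotate.conj, ?_⟩, fun i => ?_⟩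
  · rw [Equiv.Perm.support_conj, support_finRotate, Finset.map_univ_equiv]
  · obtain ⟨t, rfl⟩ := q.surjective i
    have hq : q⁻¹ (q t) = t := q.symm_apply_apply t
    simp only [Equiv.Perm.mul_apply, hq]
    apply hred
    by_cases ht : t = Fin.last (m + 1)
    · subst ht
      rw [finRotate_last]
      simpa using hlast
    · rw [coe_finRotate_of_ne_last ht]
      apply hnear
      have := Fin.val_lt_last ht
      omega

lemma not_dvd_of_lt_two_mul {n : ℕ} {z : ℤ} (h0 : z ≠ 0) (h1 : z ≠ n) (h2 : z ≠ -n)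
    (h3 : z < 2 * n) (h4 : -(2 * n) < z) : ¬ (n : ℤ) ∣ z := by
  rintro ⟨k, rfl⟩
  have hk1 : k < 2 := by by_contra! h; nlinarith
  have hk2 : -2 < k := by by_contra! h; nlinarith
  obtain rfl | rfl | rfl : k = -1 ∨ k = 0 ∨ k = 1 := by omega
  all_goals simp at h0 h1 h2

/-- For every `c` there is a zigzag Hamiltonian cycle with all edge sums near `c`. -/
lemma exists_hamCycle_nearSum {n : ℕ} (hn : 3 ≤ n) (c : ℕ) :
    ∃ σ : Equiv.Perm (Fin n), IsHamCycle σ ∧ ∀ i : Fin n, NearSum n c i (σ i) := by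
  rcases Nat.even_or_odd' n with ⟨m, hm | hm⟩
  · rcases Nat.even_or_odd' c with ⟨p, rfl | rfl⟩
    · refine exists_hamCycle_of_seq hn (fun t => if t % 2 = 0 then p - t else p + t) ?_ ?_ ?_
      · intro s t hst ht
        apply not_dvd_of_lt_two_mul <;> split_ifs <;> omega
      · intro t ht
        split_ifs
        · omega
        · exact ⟨1, 0, by omega, by omega, by omega⟩
        · exact ⟨-1, 0, by omega, by omega, by omega⟩
        · omega
      · rw [if_neg (by omega), if_pos (by omega)]
        exact ⟨-1, 1, by omega, by omega, by omega⟩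
    · refine exists_hamCycle_of_seq hn
        (fun t => if (t < m ↔ t % 2 = 0) then p - t else p + t + 1) ?_ ?_ ?_
      · intro s t hst ht
        apply not_dvd_of_lt_two_mul <;> split_ifs <;> omega
      · intro t ht
        by_cases htm : t + 1 = m
        · rcases Nat.mod_two_eq_zero_or_one t with h | h
          · rw [if_pos (by omega), if_pos (by omega)]
            exact ⟨0, -1, by omega, by omega, by omega⟩
          · rw [if_neg (by omega), if_neg (by omega)]
            exact ⟨0, 1, by omega, by omega, by omega⟩
        · split_ifs
          · omega
          · exact ⟨1, 0, by omega, by omega, by omega⟩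
          · exact ⟨-1, 0, by omega, by omega, by omega⟩
          · omega
      · rw [if_pos (by omega), if_pos (by omega)]
        exact ⟨0, -1, by omega, by omega, by omega⟩
  · obtain ⟨p, j, hp⟩ : ∃ p j : ℤ, 2 * p + 1 = c + n * j := by
      rcases Nat.even_or_odd' c with ⟨p, hp | hp⟩
      · exact ⟨p + m, 1, by omega⟩
      · exact ⟨p, 0, by omega⟩
    refine exists_hamCycle_of_seq hn (fun t => if t % 2 = 0 then p - t else p + t + 1) ?_ ?_ ?_
    · intro s t hst ht
      apply not_dvd_of_lt_two_mul <;> split_ifs <;> omega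
    · intro t ht
      split_ifs
      · omega
      · exact ⟨1, j, by omega, by omega, by push_cast; linarith⟩
      · exact ⟨-1, j, by omega, by omega, by push_cast; linarith⟩
      · omega
    · rw [if_pos (by omega), if_pos (by omega)]
      refine ⟨0, j - 1, by omega, by omega, ?_⟩
      push_cast [Nat.cast_sub (show 1 ≤ n by omega)]
      linarith

/-- on any `n ≥ 3` points in convex position there is a family of
`⌊n / 3⌋` pairwise edge-disjoint 1-plane Hamiltonian cycles. -/
theorem stmt8 {n : ℕ} (hn : 3 ≤ n) (v : Fin n → Pt) (hconv : ConvexCcw v) :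
    ∃ S : Finset (Equiv.Perm (Fin n)), S.card = n / 3 ∧
      (∀ σ ∈ S, IsOnePlaneHC v σ) ∧
      (∀ σ ∈ S, ∀ τ ∈ S, σ ≠ τ → Disjoint (cycEdges σ) (cycEdges τ)) := by
  choose σ hham hsum using fun k : ℕ => exists_hamCycle_nearSum hn (3 * k)
  have hshape : ∀ k, ∀ e ∈ cycEdges (σ k),
      ∃ a b : Fin n, a < b ∧ e = s(a, b) ∧ NearSum n (3 * k : ℕ) a b := by
    rintro k e ⟨i, rfl⟩
    have hi : σ k i ≠ i := by
      rw [← Equiv.Perm.mem_support, (hham k).2]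
      exact mem_univ i
    rcases hi.lt_or_gt with h | h
    · exact ⟨_, _, h, Sym2.eq_swap, (hsum k i).symm⟩
    · exact ⟨_, _, h, rfl, hsum k i⟩
  have heq : ∀ k < n / 3, ∀ l < n / 3, ∀ e ∈ cycEdges (σ k), e ∈ cycEdges (σ l) → k = l := by
    intro k hk l hl e he he'
    obtain ⟨a, b, hab, rfl, d, j, hd, hd', h⟩ := hshape k _ he
    obtain ⟨a', b', hab', heq, d', j', hd1, hd1', h'⟩ := hshape l _ he'
    have hs : (a + b : ℤ) = a' + b' := by
      rcases Sym2.eq_iff.mp heq with ⟨rfl, rfl⟩ | ⟨rfl, rfl⟩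
      · rfl
      · ring
    have hj : (n : ℤ) * (j - j') = 3 * l + d' - 3 * k - d := by push_cast at h h'; linarith
    have hk3 : 3 * k + 3 ≤ n := by omega
    have hl3 : 3 * l + 3 ≤ n := by omega
    have h1 : j - j' < 1 := by by_contra! hcon; nlinarith
    have h2 : -1 < j - j' := by by_contra! hcon; nlinarith
    have h3 : j - j' = 0 := by omega
    rw [h3] at hj
    omega
  refine ⟨(range (n / 3)).image σ, ?_, ?_, ?_⟩
  · rw [card_image_of_injOn, card_range]
    intro k hk l hl hkl
    refine heq k (by simpa using hk) l (by simpa using hl) s(⟨0, by omega⟩, σ k ⟨0, by omega⟩)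
      ⟨_, rfl⟩ ?_
    rw [← hkl]
    exact ⟨_, rfl⟩
  · simp only [mem_image, mem_range]
    rintro _ ⟨k, -, rfl⟩
    exact ⟨hham k, onePlane_of_nearSum hn hconv (hshape k)⟩
  · simp only [mem_image, mem_range]
    rintro _ ⟨k, hk, rfl⟩ _ ⟨l, hl, rfl⟩ hne
    refine Set.disjoint_left.mpr fun e he he' => hne ?_
    rw [heq k hk l hl e he he']

end
end

section
/- Let P be a set of m ≥ 3 points in general position in the plane, let {v, w} ⊆ P, and suppose some line strictly separates {v, w} from P ∖ {v, w}. Then for every integer s with 2 ≤ s ≤ m − 1 there exists a subset P₁ ⊆ P with {v, w} ⊆ P₁ and |P₁| = s, and a line that strictly separates P₁ from P ∖ P₁. -/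
open Finset

noncomputable section

/-- A finite point set is in general position: no three of its points are collinear. -/
def GenPos (P : Finset Pt) : Prop :=
  ∀ p ∈ P, ∀ q ∈ P, ∀ r ∈ P, p ≠ q → p ≠ r → q ≠ r →
    ¬ Collinear ℝ ({p, q, r} : Set Pt)

/-- A line strictly separates the point sets `A` and `B`: they lie in the two
opposite open half-planes determined by the line `a * X + b * Y = c`. -/
def StrictSep (A B : Set Pt) : Prop :=
  ∃ a b c : ℝ, (a, b) ≠ (0, 0) ∧
    (∀ p ∈ A, a * p 0 + b * p 1 < c) ∧ (∀ p ∈ B, c < a * p 0 + b * p 1)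

/-- An injective real function on a finite set cuts off initial segments of every size. -/
theorem exists_initial_segment {α : Type*} [DecidableEq α] (P : Finset α) (F : α → ℝ)
    (hF : ∀ p ∈ P, ∀ q ∈ P, p ≠ q → F p ≠ F q) (s : ℕ) (hs : s ≤ P.card) :
    ∃ A ⊆ P, A.card = s ∧ ∀ p ∈ A, ∀ q ∈ P, q ∉ A → F p < F q := by
  induction s with
  | zero => exact ⟨∅, by simp, by simp, by simp⟩
  | succ s ih =>
    obtain ⟨A, hAP, hA, hlt⟩ := ih (by omega)
    have hne : (P \ A).Nonempty := by
      rw [← Finset.card_pos, Finset.card_sdiff_of_subset hAP]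
      omega
    obtain ⟨q, hq, hmin⟩ := Finset.exists_min_image (P \ A) F hne
    rw [Finset.mem_sdiff] at hq
    refine ⟨insert q A, Finset.insert_subset hq.1 hAP, ?_, ?_⟩
    · rw [Finset.card_insert_of_notMem hq.2, hA]
    · intro p hp r hr hrA
      rw [Finset.mem_insert, not_or] at hrA
      rcases Finset.mem_insert.1 hp with rfl | hp
      · exact lt_of_le_of_ne (hmin r (Finset.mem_sdiff.2 ⟨hr, hrA.2⟩))
          (hF _ hq.1 _ hr (Ne.symm hrA.1))
      · exact hlt p hp r hr hrA.2

/-- Nonempty finite sets with ordered values have a strict threshold between them. -/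
theorem exists_threshold {α : Type*} (A B : Finset α) (F : α → ℝ) (hA : A.Nonempty)
    (hB : B.Nonempty) (h : ∀ p ∈ A, ∀ q ∈ B, F p < F q) :
    ∃ c, (∀ p ∈ A, F p < c) ∧ ∀ q ∈ B, c < F q := by
  obtain ⟨p, hp, hmax⟩ := Finset.exists_max_image A F hA
  obtain ⟨q, hq, hmin⟩ := Finset.exists_min_image B F hB
  obtain ⟨c, hpc, hcq⟩ := exists_between (h p hp q hq)
  exact ⟨c, fun x hx => (hmax x hx).trans_lt hpc, fun x hx => hcq.trans_le (hmin x hx)⟩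

open Filter Topology in
/-- The normal of a line separating `A` from the rest of `P` can be perturbed so that the
corresponding linear form is injective on `P`. -/
theorem exists_injective_separation (P : Finset Pt) (A : Set Pt) (hA : A ⊆ P)
    (hsep : StrictSep A ((P : Set Pt) \ A)) :
    ∃ a b c : ℝ, (a, b) ≠ (0, 0) ∧
      (∀ p ∈ A, a * p 0 + b * p 1 < c) ∧
      (∀ p ∈ (P : Set Pt) \ A, c < a * p 0 + b * p 1) ∧
      ∀ p ∈ P, ∀ q ∈ P, p ≠ q → a * p 0 + b * p 1 ≠ a * q 0 + b * q 1 := by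
  obtain ⟨a, b, c, hab, hlt, hgt⟩ := hsep
  have hpos : 0 < a ^ 2 + b ^ 2 := by
    by_contra hn
    apply hab
    rw [Prod.mk.injEq]
    constructor <;> nlinarith [sq_nonneg a, sq_nonneg b]
  have hcont (p : Pt) : Continuous fun t : ℝ => (a - t * b) * p 0 + (b + t * a) * p 1 := by
    fun_prop
  have hsepP : ∀ᶠ t : ℝ in 𝓝[≠] 0, ∀ p ∈ P,
      (p ∈ A → (a - t * b) * p 0 + (b + t * a) * p 1 < c) ∧
      (p ∉ A → c < (a - t * b) * p 0 + (b + t * a) * p 1) := by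
    refine (Finset.eventually_all P).2 fun p hp => eventually_nhdsWithin_of_eventually_nhds ?_
    by_cases hpA : p ∈ A
    · filter_upwards [(hcont p).continuousAt.eventually_lt_const
        (by simpa using hlt p hpA)] with t ht
      exact ⟨fun _ => ht, fun h => absurd hpA h⟩
    · filter_upwards [(hcont p).continuousAt.eventually_const_lt
        (by simpa using hgt p ⟨hp, hpA⟩)] with t ht
      exact ⟨fun h => absurd h hpA, fun _ => ht⟩
  have hinj : ∀ᶠ t : ℝ in 𝓝[≠] 0, ∀ p ∈ P, ∀ q ∈ P, p ≠ q →
      (a - t * b) * p 0 + (b + t * a) * p 1 ≠ (a - t * b) * q 0 + (b + t * a) * q 1 := by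
    refine (Finset.eventually_all P).2 fun p _ => (Finset.eventually_all P).2 fun q _ => ?_
    by_cases h : a * p 0 + b * p 1 = a * q 0 + b * q 1
    · filter_upwards [self_mem_nhdsWithin] with t ht hpq heq
      have ht : t ≠ 0 := ht
      have hg : a * (p 1 - q 1) - b * (p 0 - q 0) = 0 := by
        apply mul_left_cancel₀ ht
        linear_combination heq - h
      apply hpq
      have h0 : p 0 = q 0 := by
        apply mul_left_cancel₀ hpos.ne'
        linear_combination a * h - b * hg
      have h1 : p 1 = q 1 := by
        apply mul_left_cancel₀ hpos.ne'
        linear_combination b * h + a * hg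
      ext i
      fin_cases i
      exacts [h0, h1]
    · have hne : ∀ᶠ t : ℝ in 𝓝 0, (a - t * b) * p 0 + (b + t * a) * p 1 ≠
          (a - t * b) * q 0 + (b + t * a) * q 1 :=
        (isOpen_ne_fun (hcont p) (hcont q)).mem_nhds (by simpa using h)
      filter_upwards [eventually_nhdsWithin_of_eventually_nhds hne] with t ht _
      exact ht
  obtain ⟨t, h1, h2⟩ := (hsepP.and hinj).exists
  refine ⟨a - t * b, b + t * a, c, ?_, fun p hp => (h1 p (hA hp)).1 hp,
    fun p hp => (h1 p hp.1).2 hp.2, h2⟩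
  intro h
  rw [Prod.mk.injEq] at h
  have : a ^ 2 + b ^ 2 = 0 := by
    have : (1 + t ^ 2) * (a ^ 2 + b ^ 2) = (1 + t ^ 2) * 0 := by
      linear_combination (a - t * b) * h.1 + (b + t * a) * h.2
    exact mul_left_cancel₀ (by positivity) this
  exact hpos.ne' this

/-- if `{v, w} ⊆ P` can be strictly separated from the rest of a
set `P` of `m ≥ 3` points in general position, then for every `2 ≤ s ≤ m - 1`
some `s`-element subset `P₁` of `P` containing `v` and `w` can be strictly
separated from `P \ P₁`. -/
theorem stmt15 (P : Finset Pt) (m : ℕ) (hcard : P.card = m) (hm : 3 ≤ m)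
    (hgp : GenPos P) (v w : Pt) (hv : v ∈ P) (hw : w ∈ P) (hvw : v ≠ w)
    (hsep : StrictSep ({v, w} : Set Pt) ((P : Set Pt) \ {v, w})) :
    ∀ s : ℕ, 2 ≤ s → s ≤ m - 1 →
      ∃ P₁ : Finset Pt, P₁ ⊆ P ∧ v ∈ P₁ ∧ w ∈ P₁ ∧ P₁.card = s ∧
        StrictSep (P₁ : Set Pt) ((P : Set Pt) \ (P₁ : Set Pt)) := by
  classical
  intro s hs2 hsm
  obtain ⟨a, b, c, hab, hlt, hgt, hinj⟩ :=
    exists_injective_separation P {v, w} (by simp [Set.insert_subset_iff, hv, hw]) hsep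
  obtain ⟨A, hAP, hA, hAlt⟩ :=
    exists_initial_segment P (fun p => a * p 0 + b * p 1) hinj s (by omega)
  have hmem : ∀ x ∈ P, ∀ y, ({x, y} : Set Pt) = {v, w} → x ∈ A := by
    intro x hx y hxy
    by_contra hxA
    have hsub : A ⊆ {y} := by
      intro p hp
      have hpx := hAlt p hp x hx hxA
      have hxc := hlt x (by simp [← hxy])
      have hpvw : p ∈ ({x, y} : Set Pt) := by
        by_contra hn
        exact lt_asymm (hpx.trans hxc) (hgt p ⟨hAP hp, hxy ▸ hn⟩)
      rcases hpvw with rfl | hpy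
      · exact absurd hp hxA
      · exact Finset.mem_singleton.2 hpy
    have := Finset.card_le_card hsub
    rw [Finset.card_singleton] at this
    omega
  obtain ⟨d, hAd, hdB⟩ := exists_threshold A (P \ A) (fun p => a * p 0 + b * p 1)
    (Finset.card_pos.1 (by omega))
    (Finset.card_pos.1 (by rw [Finset.card_sdiff_of_subset hAP]; omega))
    fun p hp q hq => hAlt p hp q (Finset.mem_sdiff.1 hq).1 (Finset.mem_sdiff.1 hq).2
  exact ⟨A, hAP, hmem v hv w rfl, hmem w hw v (Set.pair_comm w v), hA, a, b, d, hab,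
    fun p hp => hAd p hp, fun p hp => hdB p (Finset.mem_sdiff.2 hp)⟩

end
end
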